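/- Let f : ℝ^d → [0,∞) be a probability density with ∫ |v|² f(v) dv < ∞ and ∫ f log f dv well-defined and finite, and let λ > 0. Then ∫_{ℝ^d} (g_λ⋆f)(v) log (g_λ⋆f)(v) dv ≤ ∫_{ℝ^d} f(v) log f(v) dv, i.e. convolution with the Gaussian g_λ does not increase the differential entropy integral ∫ f log f. -/

import Mathlib

open MeasureTheory

/-- The Gaussian density `g_λ(x) = (2πλ)^{−d/2} exp(−|x|²/(2λ))` on `ℝ^d`. -/
noncomputable def gaussDensity (d : ℕ) (lam : ℝ) (x : EuclideanSpace ℝ (Fin d)) : ℝ :=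
  (2 * Real.pi * lam) ^ (-(d : ℝ) / 2) * Real.exp (-‖x‖ ^ 2 / (2 * lam))

/-- Convolution facts for integrable real functions, written with explicit integrals. -/
lemma conv_facts {d : ℕ} {k h : EuclideanSpace ℝ (Fin d) → ℝ}
    (hk : Integrable k) (hh : Integrable h) :
    (∀ᵐ v, Integrable (fun u => k (v - u) * h u)) ∧
    Integrable (fun v => ∫ u, k (v - u) * h u) ∧
    ∫ v, ∫ u, k (v - u) * h u = (∫ v, k v) * ∫ v, h v := by
  have h1 := hh.ae_convolution_exists (ContinuousLinearMap.mul ℝ ℝ) hk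
  have h2 := hh.integrable_convolution (ContinuousLinearMap.mul ℝ ℝ) hk
  have h3 := integral_convolution (ContinuousLinearMap.mul ℝ ℝ) hh hk
  have e : (fun v => ∫ u, k (v - u) * h u)
      = convolution h k (ContinuousLinearMap.mul ℝ ℝ) volume := by
    funext v
    simp only [convolution_def, ContinuousLinearMap.mul_apply', mul_comm]
  refine ⟨?_, ?_, ?_⟩
  · filter_upwards [h1] with v hv
    have := hv.integrable
    simpa only [ContinuousLinearMap.mul_apply', mul_comm] using this
  · rw [e]; exact h2
  · rw [e, h3, ContinuousLinearMap.mul_apply', mul_comm]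

lemma integrable_exp_sq {d : ℕ} {b : ℝ} (hb : 0 < b) :
    Integrable (fun v : EuclideanSpace ℝ (Fin d) => Real.exp (-b * ‖v‖ ^ 2)) := by
  apply Integrable.of_integral_ne_zero
  rw [GaussianFourier.integral_rexp_neg_mul_sq_norm hb]
  positivity

lemma gauss_eq (d : ℕ) (lam : ℝ) (x : EuclideanSpace ℝ (Fin d)) :
    gaussDensity d lam x =
      (2 * Real.pi * lam) ^ (-(d : ℝ) / 2) * Real.exp (-(1 / (2 * lam)) * ‖x‖ ^ 2) := by
  unfold gaussDensity
  congr 2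
  ring

lemma gauss_pos (d : ℕ) {lam : ℝ} (hlam : 0 < lam) (x : EuclideanSpace ℝ (Fin d)) :
    0 < gaussDensity d lam x := by
  unfold gaussDensity
  positivity

lemma gauss_integrable (d : ℕ) {lam : ℝ} (hlam : 0 < lam) :
    Integrable (gaussDensity d lam) := by
  rw [show gaussDensity d lam = _ from funext (gauss_eq d lam)]
  exact (integrable_exp_sq (by positivity)).const_mul _

lemma gauss_integral (d : ℕ) {lam : ℝ} (hlam : 0 < lam) :
    ∫ x, gaussDensity d lam x = 1 := by
  simp_rw [gauss_eq]
  rw [integral_const_mul, GaussianFourier.integral_rexp_neg_mul_sq_norm (by positivity),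
    finrank_euclideanSpace_fin,
    show Real.pi / (1 / (2 * lam)) = 2 * Real.pi * lam by field_simp,
    ← Real.rpow_add (by positivity)]
  rw [show -(d : ℝ) / 2 + d / 2 = 0 by ring, Real.rpow_zero]

lemma gauss_moment (d : ℕ) {lam : ℝ} (hlam : 0 < lam) :
    Integrable (fun x => ‖x‖ ^ 2 * gaussDensity d lam x) := by
  have hc : Continuous (gaussDensity d lam) := by
    unfold gaussDensity; fun_prop
  have hb : (0 : ℝ) < 1 / (4 * lam) := by positivity
  refine ((integrable_exp_sq (d := d) hb).const_mul
    ((2 * Real.pi * lam) ^ (-(d : ℝ) / 2) * (4 * lam))).mono'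
    (by fun_prop) (ae_of_all _ fun x => ?_)
  rw [Real.norm_of_nonneg (mul_nonneg (by positivity) (gauss_pos d hlam x).le), gauss_eq]
  have h1 : 1 / (4 * lam) * ‖x‖ ^ 2 ≤ Real.exp (1 / (4 * lam) * ‖x‖ ^ 2) := by
    linarith [Real.add_one_le_exp (1 / (4 * lam) * ‖x‖ ^ 2)]
  have h2 : ‖x‖ ^ 2 ≤ 4 * lam * Real.exp (1 / (4 * lam) * ‖x‖ ^ 2) := by
    calc ‖x‖ ^ 2 = 4 * lam * (1 / (4 * lam) * ‖x‖ ^ 2) := by field_simp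
      _ ≤ _ := by gcongr
  have h3 : Real.exp (-(1 / (4 * lam)) * ‖x‖ ^ 2) =
      Real.exp (1 / (4 * lam) * ‖x‖ ^ 2) * Real.exp (-(1 / (2 * lam)) * ‖x‖ ^ 2) := by
    rw [← Real.exp_add]; congr 1; field_simp; ring
  rw [h3]
  have hC : 0 < (2 * Real.pi * lam) ^ (-(d : ℝ) / 2) := by positivity
  calc _ ≤ (4 * lam * Real.exp (1 / (4 * lam) * ‖x‖ ^ 2)) *
        ((2 * Real.pi * lam) ^ (-(d : ℝ) / 2) * Real.exp (-(1 / (2 * lam)) * ‖x‖ ^ 2)) := by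
        gcongr
    _ = _ := by ring

/-- Young's inequality for `t log t`. -/
lemma young_log (t s : ℝ) (ht : 0 ≤ t) :
    t * s + t - Real.exp s ≤ t * Real.log t := by
  rcases ht.eq_or_lt with rfl | ht
  · simp [Real.exp_nonneg]
  · have h := Real.add_one_le_exp (s - Real.log t)
    rw [Real.exp_sub, Real.exp_log ht, le_div_iff₀ ht] at h
    linarith

/-- convolution with the Gaussian `g_λ` does not increase the
differential entropy integral `∫ f log f`, for a probability density `f` with finite
second moment and finite entropy integral. -/
theorem gaussian_convolution_entropy_nonincreasing (d : ℕ) (lam : ℝ) (hlam : 0 < lam)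
    (f : EuclideanSpace ℝ (Fin d) → ℝ)
    (hf_meas : Measurable f) (hf_nonneg : ∀ v, 0 ≤ f v)
    (hf_prob : ∫ v, f v = 1)
    (hf_mom : Integrable (fun v => ‖v‖ ^ 2 * f v))
    (hf_ent : Integrable (fun v => f v * Real.log (f v))) :
    ∫ v, (∫ u, gaussDensity d lam (v - u) * f u) *
        Real.log (∫ u, gaussDensity d lam (v - u) * f u)
      ≤ ∫ v, f v * Real.log (f v) := by
  have hg := gauss_integrable d hlam
  have hf : Integrable f := .of_integral_ne_zero (by rw [hf_prob]; exact one_ne_zero)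
  have gpos := gauss_pos d hlam
  obtain ⟨a1, b1, -⟩ := conv_facts hg hf
  obtain ⟨a2, b2, c2⟩ := conv_facts hg hf_ent
  obtain ⟨a3, b3, -⟩ := conv_facts hg hf_mom
  obtain ⟨a4, b4, -⟩ := conv_facts (gauss_moment d hlam) hf
  rw [gauss_integral d hlam, one_mul] at c2
  set F : EuclideanSpace ℝ (Fin d) → ℝ := fun v => ∫ u, gaussDensity d lam (v - u) * f u with hF
  have Fnn : ∀ v, 0 ≤ F v := fun v =>
    integral_nonneg fun u => mul_nonneg (gpos _).le (hf_nonneg u)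
  -- Jensen
  have upper : ∀ᵐ v, F v * Real.log (F v) ≤
      ∫ u, gaussDensity d lam (v - u) * (f u * Real.log (f u)) := by
    filter_upwards [a1, a2] with v h1 h2
    rcases (Fnn v).eq_or_lt with h0 | h0
    · have hz := (integral_eq_zero_iff_of_nonneg
        (fun u => mul_nonneg (gpos (v - u)).le (hf_nonneg u)) h1).1 h0.symm
      rw [← h0, zero_mul]
      apply integral_nonneg_of_ae
      filter_upwards [hz] with u hu
      have : f u = 0 := by
        rcases mul_eq_zero.1 hu with h | h
        · exact absurd h (gpos _).ne'
        · exact h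
      simp [this]
    · have hgv : Integrable (fun u => gaussDensity d lam (v - u)) := hg.comp_sub_left v
      have hI : ∫ u, gaussDensity d lam (v - u) = 1 := by
        rw [integral_sub_left_eq_self (gaussDensity d lam) volume v, gauss_integral d hlam]
      have key : ∫ u, ((gaussDensity d lam (v - u) * f u) * (Real.log (F v) + 1)
          - gaussDensity d lam (v - u) * F v) ≤
          ∫ u, gaussDensity d lam (v - u) * (f u * Real.log (f u)) := by
        refine integral_mono ((h1.mul_const _).sub (hgv.mul_const _)) h2 fun u => ?_
        have := young_log (f u) (Real.log (F v)) (hf_nonneg u)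
        rw [Real.exp_log h0] at this
        have := mul_le_mul_of_nonneg_left this (gpos (v - u)).le
        dsimp only
        linarith
      rw [integral_sub (h1.mul_const _) (hgv.mul_const _), integral_mul_const,
        integral_mul_const, hI] at key
      change F v * (Real.log (F v) + 1) - 1 * F v ≤ _ at key
      linarith
  -- second moment of `F`
  have mom : Integrable (fun v => ‖v‖ ^ 2 * F v) := by
    refine ((b4.add b3).const_mul 2).mono'
      ((by fun_prop : AEStronglyMeasurable
        (fun v : EuclideanSpace ℝ (Fin d) => ‖v‖ ^ 2) volume).mul b1.aestronglyMeasurable) ?_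
    filter_upwards [a1, a3, a4] with v h1 h3 h4
    rw [Real.norm_of_nonneg (mul_nonneg (by positivity) (Fnn v)), Pi.add_apply,
      ← integral_add h4 h3, ← integral_const_mul, ← integral_const_mul]
    refine integral_mono (h1.const_mul _) ((h4.add h3).const_mul _) fun u => ?_
    have hn : ‖v‖ ^ 2 ≤ 2 * (‖v - u‖ ^ 2 + ‖u‖ ^ 2) := by
      have : ‖v‖ ≤ ‖v - u‖ + ‖u‖ := by simpa using norm_add_le (v - u) u
      nlinarith [norm_nonneg v, sq_nonneg (‖v - u‖ - ‖u‖)]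
    have := mul_le_mul_of_nonneg_right hn (mul_nonneg (gpos (v - u)).le (hf_nonneg u))
    simp only [Pi.add_apply]
    linarith
  have hexp : Integrable (fun v : EuclideanSpace ℝ (Fin d) => Real.exp (-1 * ‖v‖ ^ 2)) :=
    integrable_exp_sq one_pos
  have hint : Integrable (fun v => F v * Real.log (F v)) := by
    have hmeas : AEStronglyMeasurable (fun v => F v * Real.log (F v)) volume :=
      (b1.aemeasurable.mul (Real.measurable_log.comp_aemeasurable
        b1.aemeasurable)).aestronglyMeasurable
    refine integrable_of_le_of_le hmeas (ae_of_all _ fun v => ?_) upper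
      ((b1.sub mom).sub hexp) b2
    have := young_log (F v) (-1 * ‖v‖ ^ 2) (Fnn v)
    simp only [Pi.sub_apply]
    change F v - _ - _ ≤ _
    linarith
  rw [← c2]
  exact integral_mono_ae hint b2 upper
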